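/- Let P be the Pell sequence (P_0 = 0, P_1 = 1, P_n = 2P_{n-1} + P_{n-2}) and Q the associated Pell sequence (Q_0 = 1, Q_1 = 1, Q_n = 2Q_{n-1} + Q_{n-2}). For all i, k ≥ 1: if k is even then (P_{2k+2i} − P_{2i})/2 − (P_{2k+2i−2} − P_{2i−2})/2 = 2·P_k·Q_{k+2i−1}, and if k is odd then (P_{2k+2i} − P_{2i})/2 − (P_{2k+2i−2} − P_{2i−2})/2 = 2·Q_k·P_{k+2i−1}. -/

import Mathlib

/-- The Pell sequence: P₀ = 0, P₁ = 1, Pₙ = 2Pₙ₋₁ + Pₙ₋₂. -/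
def pell : ℕ → ℤ
  | 0 => 0
  | 1 => 1
  | n + 2 => 2 * pell (n + 1) + pell n

/-- The associated Pell sequence: Q₀ = 1, Q₁ = 1, Qₙ = 2Qₙ₋₁ + Qₙ₋₂. -/
def assocPell : ℕ → ℤ
  | 0 => 1
  | 1 => 1
  | n + 2 => 2 * assocPell (n + 1) + assocPell n

theorem pell_assocPell_succ (n : ℕ) :
    pell (n + 1) = pell n + assocPell n ∧ assocPell (n + 1) = assocPell n + 2 * pell n := by
  induction n with
  | zero => simp [pell, assocPell]
  | succ n ih =>
    obtain ⟨h₁, h₂⟩ := ih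
    simp only [pell, assocPell]
    constructor <;> linarith

theorem pell_succ (n : ℕ) : pell (n + 1) = pell n + assocPell n :=
  (pell_assocPell_succ n).1

theorem assocPell_succ (n : ℕ) : assocPell (n + 1) = assocPell n + 2 * pell n :=
  (pell_assocPell_succ n).2

theorem pell_assocPell_add (m n : ℕ) :
    pell (m + n) = pell m * assocPell n + assocPell m * pell n ∧
      assocPell (m + n) = assocPell m * assocPell n + 2 * pell m * pell n := by
  induction n with
  | zero => simp [pell, assocPell]
  | succ n ih =>
    simp only [← add_assoc, pell_succ, assocPell_succ, ih.1, ih.2]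
    constructor <;> ring

theorem pell_add (m n : ℕ) :
    pell (m + n) = pell m * assocPell n + assocPell m * pell n :=
  (pell_assocPell_add m n).1

theorem assocPell_add (m n : ℕ) :
    assocPell (m + n) = assocPell m * assocPell n + 2 * pell m * pell n :=
  (pell_assocPell_add m n).2

theorem assocPell_sq_sub (n : ℕ) : assocPell n ^ 2 - 2 * pell n ^ 2 = (-1) ^ n := by
  induction n with
  | zero => simp [pell, assocPell]
  | succ n ih =>
    rw [pell_succ, assocPell_succ, pow_succ (-1), ← ih]
    ring

theorem pell_add_sub (m k : ℕ) :
    pell (m + k + k) - (-1) ^ k * pell m = 2 * pell k * assocPell (m + k) := by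
  rw [← assocPell_sq_sub, pell_add (m + k), pell_add, assocPell_add]
  ring

theorem pell_add_add (m k : ℕ) :
    pell (m + k + k) + (-1) ^ k * pell m = 2 * assocPell k * pell (m + k) := by
  rw [← assocPell_sq_sub, pell_add (m + k), pell_add, assocPell_add]
  ring

theorem halved_pell_sub (m n : ℕ) :
    (pell (m + 2) - pell (n + 2)) / 2 - (pell m - pell n) / 2 =
      pell (m + 1) - pell (n + 1) := by
  simp only [pell]
  omega

theorem halved_pell_diff (i k : ℕ) (hi : 1 ≤ i) (hk : 1 ≤ k) :
    (Even k →
      (pell (2 * k + 2 * i) - pell (2 * i)) / 2 -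
          (pell (2 * k + 2 * i - 2) - pell (2 * i - 2)) / 2 =
        2 * pell k * assocPell (k + 2 * i - 1)) ∧
    (Odd k →
      (pell (2 * k + 2 * i) - pell (2 * i)) / 2 -
          (pell (2 * k + 2 * i - 2) - pell (2 * i - 2)) / 2 =
        2 * assocPell k * pell (k + 2 * i - 1)) := by
  obtain ⟨j, rfl⟩ := Nat.exists_eq_add_of_le' hi
  rw [show 2 * k + 2 * (j + 1) = 2 * k + 2 * j + 2 by ring, show 2 * (j + 1) = 2 * j + 2 by ring,
    Nat.add_sub_cancel, Nat.add_sub_cancel, halved_pell_sub,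
    show 2 * k + 2 * j + 1 = 2 * j + 1 + k + k by ring,
    show k + (2 * j + 2) - 1 = 2 * j + 1 + k by omega]
  constructor <;> intro h
  · rw [← pell_add_sub, h.neg_one_pow, one_mul]
  · rw [← pell_add_add, h.neg_one_pow, neg_one_mul, sub_eq_add_neg]
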